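/- Let x ∈ S_ρ and let i be a node with x_i > 0. Then the 'all-stay' allocation (d_i = x_i and d_j = 0 for every neighbor j of i) is an optimal solution of problem P2^i if and only if u_i(x_i) ≥ u_j(x_j) for every neighbor j of i in G. -/

import Mathlib

open Finset

theorem tangent_aux (f g : ℝ → ℝ) (h : ∀ y, HasDerivAt f (g y) y) (hg : StrictAnti g)
    (a b : ℝ) : f b - f a ≤ g a * (b - a) := by
  have hc : Continuous f := continuous_iff_continuousAt.2 fun y => (h y).continuousAt
  rcases lt_trichotomy a b with hab | hab | hab
  · obtain ⟨c, hc1, hc2⟩ := exists_hasDerivAt_eq_slope f g hab hc.continuousOn fun y _ => h y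
    have h1 := hg hc1.1
    have h0 : 0 < b - a := sub_pos.2 hab
    rw [eq_div_iff h0.ne'] at hc2
    nlinarith
  · subst hab; simp
  · obtain ⟨c, hc1, hc2⟩ := exists_hasDerivAt_eq_slope f g hab hc.continuousOn fun y _ => h y
    have h1 := hg hc1.2
    have h0 : 0 < a - b := sub_pos.2 hab
    rw [eq_div_iff h0.ne'] at hc2
    nlinarith

/-- **Characterization of the 'all-stay' allocation being optimal in the nodal
best response problem `P2^i`.** Here `p j` is continuously differentiable and
strictly concave with derivative `u j` (hence `u j` is continuous and
strictly decreasing). For `x ∈ S_ρ` and a node `i` with `x i > 0`, the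
allocation keeping all of `x i` in node `i` (whose objective value is
`p i (x i) - p i 0`) is optimal for `P2^i` if and only if
`u i (x i) ≥ u j (x j)` for every neighbor `j` of `i`. -/
theorem allstay_optimal_iff_nodal_nash {V : Type*} [Fintype V] [Nonempty V]
    [DecidableEq V]
    (G : SimpleGraph V) [DecidableRel G.Adj]
    (p u : V → ℝ → ℝ)
    (hderiv : ∀ j y, HasDerivAt (p j) (u j y) y)
    (hcont : ∀ j, Continuous (u j))
    (hconc : ∀ j, StrictConcaveOn ℝ Set.univ (p j))
    (hu : ∀ j, StrictAnti (u j))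
    (ρ : ℝ) (hρ : 0 ≤ ρ) (x : V → ℝ)
    (hx0 : ∀ j, 0 ≤ x j) (hxsum : ∑ j, x j = ρ)
    (i : V) (hxi : 0 < x i) :
    (∀ d : V → ℝ,
        (∀ j ∈ insert i (G.neighborFinset i), 0 ≤ d j) →
        (∑ j ∈ insert i (G.neighborFinset i), d j = x i) →
        (∑ j ∈ G.neighborFinset i, (p j (x j + d j) - p j (x j)))
            + (p i (d i) - p i 0)
          ≤ p i (x i) - p i 0)
      ↔ (∀ j ∈ G.neighborFinset i, u j (x j) ≤ u i (x i)) := by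
  have hni : i ∉ G.neighborFinset i := by simp
  have T := fun j => tangent_aux (p j) (u j) (hderiv j) (hu j)
  constructor
  · intro H j hj
    have hji : j ≠ i := fun h => hni (h ▸ hj)
    have key : ∀ ε ∈ Set.Ioo 0 (x i), u j (x j + ε) ≤ u i (x i - ε) := by
      intro ε hε
      have hd : ∀ k ∈ G.neighborFinset i, k ≠ i := fun k hk h => hni (h ▸ hk)
      have h1 := H (fun k => if k = i then x i - ε else if k = j then ε else 0) ?_ ?_
      · have e : ∑ k ∈ G.neighborFinset i, (p k (x k + (if k = i then x i - ε else
            if k = j then ε else 0)) - p k (x k)) = p j (x j + ε) - p j (x j) := by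
          rw [Finset.sum_eq_single_of_mem j hj]
          · simp [hji]
          · intro k hk hkj
            simp [hd k hk, hkj]
        rw [e] at h1
        simp only [if_true] at h1
        have h2 := T j (x j + ε) (x j)
        have h3 := T i (x i - ε) (x i)
        have h0 := hε.1
        by_contra hlt
        push Not at hlt
        nlinarith
      · intro k _
        have := hε.1
        have := hε.2
        split_ifs <;> linarith
      · rw [Finset.sum_insert hni, Finset.sum_eq_single_of_mem j hj]
        · simp [hji]
        · intro k hk hkj
          simp [hd k hk, hkj]
    have c1 : Continuous fun ε => u j (x j + ε) := (hcont j).comp (by fun_prop)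
    have c2 : Continuous fun ε => u i (x i - ε) := (hcont i).comp (by fun_prop)
    have t1 := (c1.tendsto 0).mono_left (nhdsWithin_le_nhds (s := Set.Ioi 0))
    have t2 := (c2.tendsto 0).mono_left (nhdsWithin_le_nhds (s := Set.Ioi 0))
    have := le_of_tendsto_of_tendsto t1 t2
      (Filter.eventually_of_mem (Ioo_mem_nhdsGT hxi) key)
    simpa using this
  · intro H d hd hs
    rw [Finset.sum_insert hni] at hs
    have h1 : ∑ j ∈ G.neighborFinset i, (p j (x j + d j) - p j (x j))
        ≤ ∑ j ∈ G.neighborFinset i, u i (x i) * d j := by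
      apply Finset.sum_le_sum
      intro j hj
      have h2 := T j (x j) (x j + d j)
      have h3 := mul_le_mul_of_nonneg_right (H j hj) (hd j (Finset.mem_insert_of_mem hj))
      rw [add_sub_cancel_left] at h2
      linarith
    rw [← Finset.mul_sum] at h1
    have h4 := T i (x i) (d i)
    have h5 : ∑ j ∈ G.neighborFinset i, d j = x i - d i := by linarith
    rw [h5] at h1
    linarith
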